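/- Let s > 3/2, let m ≥ 2 be an integer, and let δ, δ₁, …, δ_m ∈ ℝ satisfy δ ≤ δ₁ + ⋯ + δ_m + 3(m−1)/2. Then there is a constant C, independent of the functions involved, such that for all u_i ∈ H_{s,δ_i} (i = 1, …, m), the product u = u₁u₂⋯u_m belongs to H_{s,δ} and ‖u‖_{H_{s,δ}} ≤ C ∏_{i=1}^m ‖u_i‖_{H_{s,δ_i}}. -/

import Mathlib

open MeasureTheory Real Set
open scoped FourierTransform ENNReal NNReal

noncomputable section

abbrev E3 : Type := EuclideanSpace ℝ (Fin 3)

/-- A dyadic partition of unity on ℝ³ as in the paper: `ψ j ∈ C_0^∞`, nonnegative,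
`supp ψ₀ ⊆ {|x| ≤ 2}`, `ψ₀ = 1` on `{|x| ≤ 1}`, for `j ≥ 1`
`supp ψ_j ⊆ {2^(j-2) ≤ |x| ≤ 2^(j+1)}`, `ψ_j = 1` on `{2^(j-1) ≤ |x| ≤ 2^j}`, and
`|∂^α ψ_j| ≤ C_α 2^(-|α| j)` with `C_α` independent of `j`. -/
structure DyadicPartition where
  ψ : ℕ → E3 → ℝ
  smooth : ∀ j, ContDiff ℝ (⊤ : ℕ∞) (ψ j)
  nonneg : ∀ j x, 0 ≤ ψ j x
  compSupp : ∀ j, HasCompactSupport (ψ j)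
  supp_zero : ∀ x : E3, ψ 0 x ≠ 0 → ‖x‖ ≤ 2
  one_zero : ∀ x : E3, ‖x‖ ≤ 1 → ψ 0 x = 1
  supp_succ : ∀ j : ℕ, 1 ≤ j → ∀ x : E3, ψ j x ≠ 0 →
    (2:ℝ) ^ ((j:ℤ) - 2) ≤ ‖x‖ ∧ ‖x‖ ≤ (2:ℝ) ^ ((j:ℤ) + 1)
  one_succ : ∀ j : ℕ, 1 ≤ j → ∀ x : E3,
    (2:ℝ) ^ ((j:ℤ) - 1) ≤ ‖x‖ → ‖x‖ ≤ (2:ℝ) ^ (j:ℤ) → ψ j x = 1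
  deriv_bound : ∀ n : ℕ, ∃ C : ℝ, ∀ (j : ℕ) (x : E3),
    ‖iteratedFDeriv ℝ n (ψ j) x‖ ≤ C * (2:ℝ) ^ (-(n:ℤ) * (j:ℤ))

/-- The squared `H^s` norm `∫ (1+|ξ|²)^s |𝓕f(ξ)|² dξ` of a complex-valued function. -/
def HsNormSq (s : ℝ) (f : E3 → ℂ) : ℝ≥0∞ :=
  ∫⁻ ξ : E3, ENNReal.ofReal ((1 + ‖ξ‖ ^ 2) ^ s) * (‖𝓕 f ξ‖₊ : ℝ≥0∞) ^ 2

/-- The squared weighted Sobolev norm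
`‖u‖²_{H_{s,δ}} = Σ_j 2^{(3/2+δ)2j} ‖(ψ_j u)_{2^j}‖²_{H^s}`,
where `(ψ_j u)_{2^j}(x) = ψ_j(2^j x) u(2^j x)`. -/
def HwNormSq (P : DyadicPartition) (s δ : ℝ) (u : E3 → ℝ) : ℝ≥0∞ :=
  ∑' j : ℕ, ENNReal.ofReal ((2:ℝ) ^ ((3 + 2 * δ) * (j:ℝ))) *
    HsNormSq s (fun x : E3 =>
      ((P.ψ j (((2:ℝ) ^ (j:ℕ)) • x) * u (((2:ℝ) ^ (j:ℕ)) • x) : ℝ) : ℂ))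

/-- Membership in the weighted Sobolev space `H_{s,δ}` (for functions). -/
def MemH (P : DyadicPartition) (s δ : ℝ) (u : E3 → ℝ) : Prop :=
  LocallyIntegrable u volume ∧ HwNormSq P s δ u < ⊤

/-- The weighted Sobolev norm `‖u‖_{H_{s,δ}}`. -/
def Hnorm (P : DyadicPartition) (s δ : ℝ) (u : E3 → ℝ) : ℝ :=
  Real.sqrt (HwNormSq P s δ u).toReal

/-- The squared weighted `L²_δ` norm `∫ (1+|x|)^{2δ} |u(x)|² dx`. -/
def L2wNormSq (δ : ℝ) (u : E3 → ℝ) : ℝ≥0∞ :=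
  ∫⁻ x : E3, ENNReal.ofReal ((1 + ‖x‖) ^ (2 * δ)) * (‖u x‖₊ : ℝ≥0∞) ^ 2

/-- The weighted `L²_δ` norm. -/
def L2wNorm (δ : ℝ) (u : E3 → ℝ) : ℝ :=
  Real.sqrt (L2wNormSq δ u).toReal

/-- Membership in `L²_δ`. -/
def MemL2w (δ : ℝ) (u : E3 → ℝ) : Prop :=
  AEStronglyMeasurable u volume ∧ L2wNormSq δ u < ⊤

/-- The partial derivative `∂_a f (x)`. -/
def pd (f : E3 → ℝ) (a : Fin 3) (x : E3) : ℝ :=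
  fderiv ℝ f x (EuclideanSpace.single a 1)

section Fourier

variable {V : Type*} [NormedAddCommGroup V] [InnerProductSpace ℝ V] [FiniteDimensional ℝ V]
  [MeasurableSpace V] [BorelSpace V]

/-- The Fourier transform on `L¹` is self-adjoint for the bilinear pairing. -/
lemma integral_fourier_mul_eq {f g : V → ℂ} (hf : Integrable f) (hg : Integrable g) :
    ∫ ξ, 𝓕 f ξ * g ξ = ∫ x, f x * 𝓕 g x := by
  have h := VectorFourier.integral_fourierIntegral_smul_eq_flip (e := 𝐞) (L := innerₗ V)
    (μ := (volume : Measure V)) (ν := (volume : Measure V)) continuous_fourierChar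
    (by simpa using continuous_inner) hf hg
  simpa [flip_innerₗ] using! h

lemma continuous_fourier_of_integrable {f : V → ℂ} (hf : Integrable f) : Continuous (𝓕 f) :=
  VectorFourier.fourierIntegral_continuous continuous_fourierChar
    (by simpa using continuous_inner) hf

lemma norm_fourier_le_integral_norm (f : V → ℂ) (ξ : V) : ‖𝓕 f ξ‖ ≤ ∫ x, ‖f x‖ :=
  VectorFourier.norm_fourierIntegral_le_integral_norm _ _ _ _ _

lemma integral_fourierInv_mul_eq {f g : V → ℂ} (hf : Integrable f) (hg : Integrable g) :
    ∫ ξ, 𝓕⁻ f ξ * g ξ = ∫ x, f x * 𝓕⁻ g x := by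
  rw [fourierInv_eq_fourier_comp_neg f, integral_fourier_mul_eq hf.comp_neg hg,
    ← integral_neg_eq_self]
  simp [fourierInv_eq_fourier_neg]

/-- Fourier inversion almost everywhere, without continuity of the function. -/
lemma fourierInv_fourier_ae_eq {f : V → ℂ} (hf : Integrable f) (hf' : Integrable (𝓕 f)) :
    𝓕⁻ (𝓕 f) =ᵐ[volume] f := by
  have hcont : Continuous (𝓕⁻ (𝓕 f)) := by
    rw [fourierInv_eq_fourier_comp_neg]
    exact continuous_fourier_of_integrable hf'.comp_neg
  refine ae_eq_of_integral_contDiff_smul_eq hcont.locallyIntegrable hf.locallyIntegrable ?_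
  intro g hg hgs
  let φ : SchwartzMap V ℂ := HasCompactSupport.toSchwartzMap (f := fun x => (g x : ℂ))
    (hgs.comp_left (g := fun y : ℝ => (y : ℂ)) (by simp)) (Complex.ofRealCLM.contDiff.comp hg)
  have hφ : ∀ x, φ x = g x := fun x => rfl
  have hχ : Integrable (𝓕⁻ (φ : V → ℂ)) := by
    rw [← SchwartzMap.fourierInv_coe]
    exact (𝓕⁻ φ).integrable
  have hinv : 𝓕 (𝓕⁻ (φ : V → ℂ)) = φ :=
    φ.continuous.fourier_fourierInv_eq φ.integrable
      (by rw [← SchwartzMap.fourier_coe]; exact (𝓕 φ).integrable)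
  have h₁ : ∫ x, 𝓕⁻ (𝓕 f) x * φ x = ∫ x, 𝓕 f x * 𝓕⁻ (φ : V → ℂ) x :=
    integral_fourierInv_mul_eq hf' φ.integrable
  rw [integral_fourier_mul_eq hf hχ, hinv] at h₁
  simpa [hφ, mul_comm] using h₁

/-- The Fourier transform of a product is dominated by the convolution of the moduli. -/
lemma enorm_fourier_mul_le {f g : V → ℂ} (hf : Integrable f) (hf' : Integrable (𝓕 f))
    (hg : Integrable g) (ξ : V) :
    ‖𝓕 (fun x => f x * g x) ξ‖ₑ ≤ ∫⁻ η, ‖𝓕 f η‖ₑ * ‖𝓕 g (ξ - η)‖ₑ := by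
  have hk : Integrable (fun x => 𝐞 (-inner ℝ x ξ) • g x) :=
    (Real.fourierIntegral_convergent_iff ξ).2 hg
  have hk' : ∀ η, 𝓕 (fun x => 𝐞 (-inner ℝ x ξ) • g x) η = 𝓕 g (ξ + η) := by
    intro η
    simp only [fourier_eq, smul_smul, inner_add_right, neg_add_rev, AddChar.map_add_eq_mul]
  have h : 𝓕 (fun x => f x * g x) ξ = ∫ η, 𝓕 f (-η) * 𝓕 g (ξ + η) := by
    simp only [← hk']
    rw [← integral_fourier_mul_eq hf'.comp_neg hk, ← fourierInv_eq_fourier_comp_neg, fourier_eq]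
    refine integral_congr_ae ?_
    filter_upwards [fourierInv_fourier_ae_eq hf hf'] with x hx
    rw [hx]
    simp only [Circle.smul_def, smul_eq_mul]
    ring
  rw [h]
  refine (enorm_integral_le_lintegral_enorm _).trans_eq ?_
  rw [← lintegral_neg_eq_self]
  simp [enorm_mul, sub_eq_add_neg]

lemma integrable_mul_of_integrable_fourier {f g : V → ℂ} (hf : Integrable f)
    (hf' : Integrable (𝓕 f)) (hg : Integrable g) : Integrable (fun x => f x * g x) := by
  refine hg.bdd_mul (c := ∫ x, ‖𝓕 f x‖) hf.aestronglyMeasurable ?_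
  filter_upwards [fourierInv_fourier_ae_eq hf hf'] with x hx
  rw [← hx, fourierInv_eq_fourier_neg]
  exact norm_fourier_le_integral_norm _ _

lemma fourier_comp_smul (f : V → ℂ) {c : ℝ} (hc : 0 < c) (ξ : V) :
    𝓕 (fun x => f (c • x)) ξ = ((c ^ Module.finrank ℝ V)⁻¹ : ℝ) • 𝓕 f (c⁻¹ • ξ) := by
  have h := Measure.integral_comp_smul volume (fun x => 𝐞 (-inner ℝ x (c⁻¹ • ξ)) • f x) c
  rw [abs_of_pos (by positivity)] at h
  rw [fourier_eq, fourier_eq, ← h]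
  congr 1
  ext x
  rw [inner_smul_left, inner_smul_right]
  simp [hc.ne']

lemma lintegral_comp_smul (f : V → ℝ≥0∞) {c : ℝ} (hc : 0 < c) :
    ∫⁻ x, f (c • x) = ENNReal.ofReal ((c ^ Module.finrank ℝ V)⁻¹) * ∫⁻ x, f x := by
  have h := Measure.map_addHaar_smul (volume : Measure V) hc.ne'
  rw [abs_of_pos (by positivity)] at h
  rw [← smul_eq_mul, ← lintegral_smul_measure, ← h]
  exact ((Homeomorph.smulOfNeZero c hc.ne').measurableEmbedding.lintegral_map f).symm

lemma sq_lintegral_mul_le {α : Type*} [MeasurableSpace α] (μ : Measure α) {f g : α → ℝ≥0∞}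
    (hf : AEMeasurable f μ) (hg : AEMeasurable g μ) :
    (∫⁻ a, f a * g a ∂μ) ^ 2 ≤ (∫⁻ a, f a ^ 2 ∂μ) * ∫⁻ a, g a ^ 2 ∂μ := by
  have h := ENNReal.lintegral_mul_le_Lp_mul_Lq μ Real.HolderConjugate.two_two hf hg
  simp only [Pi.mul_apply, ENNReal.rpow_ofNat] at h
  refine (pow_le_pow_left' h 2).trans_eq ?_
  rw [mul_pow, ← ENNReal.rpow_natCast, ← ENNReal.rpow_natCast, ← ENNReal.rpow_mul,
    ← ENNReal.rpow_mul]
  norm_num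

end Fourier

section Sobolev

/-- The Sobolev weight `(1 + |ξ|²)^s` as an extended nonnegative real. -/
def sobWeight (s : ℝ) (ξ : E3) : ℝ≥0∞ := ENNReal.ofReal ((1 + ‖ξ‖ ^ 2) ^ s)

lemma measurable_sobWeight (s : ℝ) : Measurable (sobWeight s) := by
  unfold sobWeight
  fun_prop

lemma sobWeight_ne_top (s : ℝ) (ξ : E3) : sobWeight s ξ ≠ ⊤ := ENNReal.ofReal_ne_top

lemma sobWeight_ne_zero (s : ℝ) (ξ : E3) : sobWeight s ξ ≠ 0 := by
  have : 0 < (1 + ‖ξ‖ ^ 2) ^ s := by positivity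
  simpa [sobWeight] using this

lemma sobWeight_neg (s : ℝ) (ξ : E3) : sobWeight (-s) ξ = (sobWeight s ξ)⁻¹ := by
  unfold sobWeight
  rw [Real.rpow_neg (by positivity), ENNReal.ofReal_inv_of_pos (by positivity)]

lemma sobWeight_add (s t : ℝ) (ξ : E3) : sobWeight (s + t) ξ = sobWeight s ξ * sobWeight t ξ := by
  unfold sobWeight
  rw [Real.rpow_add (by positivity), ENNReal.ofReal_mul (by positivity)]

lemma HsNormSq_eq (s : ℝ) (f : E3 → ℂ) :
    HsNormSq s f = ∫⁻ ξ, sobWeight s ξ * ‖𝓕 f ξ‖ₑ ^ 2 := rfl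

lemma lintegral_sobWeight_neg_lt_top {s : ℝ} (hs : 3 / 2 < s) :
    ∫⁻ ξ, sobWeight (-s) ξ < ⊤ := by
  have h := integrable_rpow_neg_one_add_norm_sq (E := E3) (μ := volume) (r := 2 * s)
    (by simp; linarith)
  have h' := h.lintegral_lt_top
  have : -(2 * s) / 2 = -s := by ring
  rwa [this] at h'

lemma sobWeight_le_add {s : ℝ} (hs : 0 ≤ s) (ξ η : E3) :
    sobWeight s ξ ≤ ENNReal.ofReal (4 ^ s) * (sobWeight s η + sobWeight s (ξ - η)) := by
  unfold sobWeight
  rw [← ENNReal.ofReal_add (by positivity) (by positivity), ← ENNReal.ofReal_mul (by positivity)]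
  refine ENNReal.ofReal_le_ofReal ?_
  set a := 1 + ‖η‖ ^ 2
  set b := 1 + ‖ξ - η‖ ^ 2
  have ha : 0 < a := by positivity
  have hb : 0 < b := by positivity
  have h₁ : ‖ξ‖ ≤ ‖η‖ + ‖ξ - η‖ := by simpa using norm_add_le η (ξ - η)
  have h₂ : 1 + ‖ξ‖ ^ 2 ≤ 2 * (a + b) := by
    have : ‖ξ‖ ^ 2 ≤ (‖η‖ + ‖ξ - η‖) ^ 2 := by gcongr
    nlinarith [sq_nonneg (‖η‖ - ‖ξ - η‖)]
  have h₃ : 1 + ‖ξ‖ ^ 2 ≤ 4 * max a b := by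
    linarith [le_max_left a b, le_max_right a b]
  calc (1 + ‖ξ‖ ^ 2) ^ s ≤ (4 * max a b) ^ s := by gcongr
    _ = 4 ^ s * max a b ^ s := Real.mul_rpow (by norm_num) (by positivity)
    _ ≤ 4 ^ s * (a ^ s + b ^ s) := by
      gcongr
      rcases max_choice a b with h | h <;> rw [h] <;> linarith [rpow_pos_of_pos ha s,
        rpow_pos_of_pos hb s]

/-- Functions lying both in `L¹` and in `H^s`. -/
def MemHs (s : ℝ) (f : E3 → ℂ) : Prop := Integrable f ∧ HsNormSq s f < ⊤

lemma MemHs.integrable_fourier {s : ℝ} (hs : 3 / 2 < s) {f : E3 → ℂ} (hf : MemHs s f) :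
    Integrable (𝓕 f) := by
  refine ⟨(continuous_fourier_of_integrable hf.1).aestronglyMeasurable, ?_⟩
  have hle : ∀ ξ, ‖𝓕 f ξ‖ₑ ≤ sobWeight (-s) ξ + sobWeight s ξ * ‖𝓕 f ξ‖ₑ ^ 2 := by
    intro ξ
    have hp : 0 < (1 + ‖ξ‖ ^ 2) ^ s := by positivity
    rw [← ofReal_norm, sobWeight, sobWeight, ← ENNReal.ofReal_pow (norm_nonneg _),
      ← ENNReal.ofReal_mul hp.le, ← ENNReal.ofReal_add (by positivity) (by positivity)]
    refine ENNReal.ofReal_le_ofReal ?_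
    rw [Real.rpow_neg (by positivity)]
    set w := (1 + ‖ξ‖ ^ 2) ^ s
    set a := ‖𝓕 f ξ‖
    have ha : 0 ≤ a := norm_nonneg _
    rw [← sub_nonneg]
    have : w⁻¹ + w * a ^ 2 - a = w⁻¹ * ((w * a - 1) ^ 2 + w * a) := by field_simp; ring
    rw [this]
    positivity
  refine (lintegral_mono hle).trans_lt ?_
  rw [lintegral_add_left (measurable_sobWeight _)]
  exact ENNReal.add_lt_top.2 ⟨lintegral_sobWeight_neg_lt_top hs, hf.2⟩

/-- The constant in the algebra property of `H^s`. -/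
def algConst (s : ℝ) : ℝ≥0∞ := ENNReal.ofReal (4 ^ s) * (2 * ∫⁻ ξ : E3, sobWeight (-s) ξ)

lemma algConst_lt_top {s : ℝ} (hs : 3 / 2 < s) : algConst s < ⊤ :=
  ENNReal.mul_lt_top ENNReal.ofReal_lt_top
    (ENNReal.mul_lt_top (by simp) (lintegral_sobWeight_neg_lt_top hs))

lemma sobWeight_mul_lintegral_le {s : ℝ} (hs : 0 ≤ s) (ξ : E3) :
    sobWeight s ξ * ∫⁻ η, sobWeight (-s) η * sobWeight (-s) (ξ - η) ≤ algConst s := by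
  have hm := measurable_sobWeight (-s)
  have hle : ∀ η, sobWeight s ξ * (sobWeight (-s) η * sobWeight (-s) (ξ - η)) ≤
      ENNReal.ofReal (4 ^ s) * (sobWeight (-s) (ξ - η) + sobWeight (-s) η) := by
    intro η
    have h₁ : sobWeight s η * sobWeight (-s) η = 1 := by
      rw [sobWeight_neg, ENNReal.mul_inv_cancel (sobWeight_ne_zero s η) (sobWeight_ne_top s η)]
    have h₂ : sobWeight s (ξ - η) * sobWeight (-s) (ξ - η) = 1 := by
      rw [sobWeight_neg, ENNReal.mul_inv_cancel (sobWeight_ne_zero s _) (sobWeight_ne_top s _)]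
    calc _ ≤ ENNReal.ofReal (4 ^ s) * (sobWeight s η + sobWeight s (ξ - η)) *
          (sobWeight (-s) η * sobWeight (-s) (ξ - η)) := by
          gcongr
          exact sobWeight_le_add hs ξ η
      _ = ENNReal.ofReal (4 ^ s) * ((sobWeight s η * sobWeight (-s) η) * sobWeight (-s) (ξ - η) +
          (sobWeight s (ξ - η) * sobWeight (-s) (ξ - η)) * sobWeight (-s) η) := by ring
      _ = _ := by rw [h₁, h₂, one_mul, one_mul]
  rw [← lintegral_const_mul _ (by fun_prop)]
  refine (lintegral_mono hle).trans_eq ?_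
  rw [lintegral_const_mul _ (by fun_prop), lintegral_add_right _ hm,
    lintegral_sub_left_eq_self (sobWeight (-s)), algConst, two_mul]

/-- The algebra property of `H^s` for `s > 3/2`. -/
lemma HsNormSq_mul_le {s : ℝ} (hs : 3 / 2 < s) {f g : E3 → ℂ} (hf : MemHs s f) (hg : Integrable g) :
    HsNormSq s (fun x => f x * g x) ≤ algConst s * (HsNormSq s f * HsNormSq s g) := by
  have hF : Measurable (fun ξ => ‖𝓕 f ξ‖ₑ) :=
    (continuous_fourier_of_integrable hf.1).enorm.measurable
  have hG : Measurable (fun ξ => ‖𝓕 g ξ‖ₑ) :=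
    (continuous_fourier_of_integrable hg).enorm.measurable
  set A : E3 → ℝ≥0∞ := fun ξ => sobWeight s ξ * ‖𝓕 f ξ‖ₑ ^ 2
  set B : E3 → ℝ≥0∞ := fun ξ => sobWeight s ξ * ‖𝓕 g ξ‖ₑ ^ 2
  have hw := measurable_sobWeight
  have hAm : Measurable A := (hw s).mul (hF.pow_const 2)
  have hBm : Measurable B := (hw s).mul (hG.pow_const 2)
  have hsq : ∀ t ξ, sobWeight (t / 2) ξ ^ 2 = sobWeight t ξ := by
    intro t ξ
    rw [sq, ← sobWeight_add]
    congr 1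
    ring
  have hcancel : ∀ ξ, sobWeight (-s / 2) ξ * sobWeight (s / 2) ξ = 1 := by
    intro ξ
    rw [← sobWeight_add]
    simp [sobWeight, neg_div]
  have hpt : ∀ ξ, sobWeight s ξ * ‖𝓕 (fun x => f x * g x) ξ‖ₑ ^ 2 ≤
      algConst s * ∫⁻ η, A η * B (ξ - η) := by
    intro ξ
    have hsub : Measurable (fun η : E3 => ξ - η) := by fun_prop
    have h₁ : (∫⁻ η, ‖𝓕 f η‖ₑ * ‖𝓕 g (ξ - η)‖ₑ) ^ 2 ≤
        (∫⁻ η, sobWeight (-s) η * sobWeight (-s) (ξ - η)) * ∫⁻ η, A η * B (ξ - η) := by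
      have h := sq_lintegral_mul_le (volume : Measure E3)
        (f := fun η => sobWeight (-s / 2) η * sobWeight (-s / 2) (ξ - η))
        (g := fun η => (sobWeight (s / 2) η * ‖𝓕 f η‖ₑ) *
          (sobWeight (s / 2) (ξ - η) * ‖𝓕 g (ξ - η)‖ₑ))
        ((hw _).mul ((hw _).comp hsub)).aemeasurable
        ((((hw _).mul hF)).mul (((hw _).mul hG).comp hsub)).aemeasurable
      simp only [mul_pow, hsq] at h
      refine le_trans (le_of_eq ?_) h
      congr 2
      ext η
      rw [show ∀ a b c d e f : ℝ≥0∞, a * b * (c * d * (e * f)) = (a * c) * (b * e) * (d * f) by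
        intros; ring, hcancel, hcancel, one_mul, one_mul]
    calc _ ≤ sobWeight s ξ * (∫⁻ η, ‖𝓕 f η‖ₑ * ‖𝓕 g (ξ - η)‖ₑ) ^ 2 := by
          gcongr
          exact enorm_fourier_mul_le hf.1 (hf.integrable_fourier hs) hg ξ
      _ ≤ sobWeight s ξ * ((∫⁻ η, sobWeight (-s) η * sobWeight (-s) (ξ - η)) *
          ∫⁻ η, A η * B (ξ - η)) := by gcongr
      _ ≤ _ := by
        rw [← mul_assoc]
        gcongr
        exact sobWeight_mul_lintegral_le (by linarith) ξ
  rw [HsNormSq_eq]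
  refine (lintegral_mono hpt).trans ?_
  have hAB : Measurable (Function.uncurry fun ξ η : E3 => A η * B (ξ - η)) :=
    (hAm.comp measurable_snd).mul (hBm.comp (measurable_fst.sub measurable_snd))
  rw [lintegral_const_mul' _ _ (algConst_lt_top hs).ne, lintegral_lintegral_swap hAB.aemeasurable]
  gcongr
  refine le_of_eq ?_
  have : ∀ η, ∫⁻ ξ, A η * B (ξ - η) = A η * ∫⁻ ξ, B ξ := by
    intro η
    rw [lintegral_const_mul _ (by fun_prop), lintegral_sub_right_eq_self B η]
  simp_rw [this]
  rw [lintegral_mul_const _ hAm]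
  rfl

lemma MemHs.mul {s : ℝ} (hs : 3 / 2 < s) {f g : E3 → ℂ} (hf : MemHs s f) (hg : MemHs s g) :
    MemHs s (fun x => f x * g x) :=
  ⟨integrable_mul_of_integrable_fourier hf.1 (hf.integrable_fourier hs) hg.1,
    (HsNormSq_mul_le hs hf hg.1).trans_lt
      (ENNReal.mul_lt_top (algConst_lt_top hs) (ENNReal.mul_lt_top hf.2 hg.2))⟩

lemma fourier_add_of_integrable {f g : E3 → ℂ} (hf : Integrable f) (hg : Integrable g) (ξ : E3) :
    𝓕 (fun x => f x + g x) ξ = 𝓕 f ξ + 𝓕 g ξ := by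
  simp only [fourier_eq, smul_add]
  exact integral_add ((Real.fourierIntegral_convergent_iff ξ).2 hf)
    ((Real.fourierIntegral_convergent_iff ξ).2 hg)

lemma HsNormSq_add_le (s : ℝ) {f g : E3 → ℂ} (hf : Integrable f) (hg : Integrable g) :
    HsNormSq s (fun x => f x + g x) ≤ 2 * (HsNormSq s f + HsNormSq s g) := by
  have hF : Measurable (fun ξ => ‖𝓕 f ξ‖ₑ) :=
    (continuous_fourier_of_integrable hf).enorm.measurable
  have hw := measurable_sobWeight s
  simp only [HsNormSq_eq]
  rw [← lintegral_add_left (by fun_prop), ← lintegral_const_mul' _ _ (by simp)]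
  refine lintegral_mono fun ξ => ?_
  rw [fourier_add_of_integrable hf hg]
  calc _ ≤ sobWeight s ξ * (2 * (‖𝓕 f ξ‖ₑ ^ 2 + ‖𝓕 g ξ‖ₑ ^ 2)) := by
        gcongr
        refine (pow_le_pow_left' (enorm_add_le _ _) 2).trans ?_
        have := ENNReal.rpow_add_le_mul_rpow_add_rpow ‖𝓕 f ξ‖ₑ ‖𝓕 g ξ‖ₑ (p := 2) (by norm_num)
        norm_num at this
        exact this
    _ = _ := by ring

lemma HsNormSq_neg (s : ℝ) (f : E3 → ℂ) : HsNormSq s (fun x => -f x) = HsNormSq s f := by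
  have : ∀ ξ, 𝓕 (fun x => -f x) ξ = -𝓕 f ξ := by
    intro ξ
    simp only [fourier_eq, smul_neg, integral_neg]
  simp only [HsNormSq_eq, this, enorm_neg]

lemma HsNormSq_sub_le (s : ℝ) {f g : E3 → ℂ} (hf : Integrable f) (hg : Integrable g) :
    HsNormSq s (fun x => f x - g x) ≤ 2 * (HsNormSq s f + HsNormSq s g) := by
  have h := HsNormSq_add_le s hf hg.neg
  simp only [Pi.neg_apply, ← sub_eq_add_neg] at h
  refine h.trans_eq ?_
  rw [← HsNormSq_neg s g]
  rfl

lemma MemHs.add {s : ℝ} {f g : E3 → ℂ} (hf : MemHs s f) (hg : MemHs s g) :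
    MemHs s (fun x => f x + g x) :=
  ⟨hf.1.add hg.1, (HsNormSq_add_le s hf.1 hg.1).trans_lt
    (ENNReal.mul_lt_top (by simp) (ENNReal.add_lt_top.2 ⟨hf.2, hg.2⟩))⟩

lemma MemHs.sub {s : ℝ} {f g : E3 → ℂ} (hf : MemHs s f) (hg : MemHs s g) :
    MemHs s (fun x => f x - g x) :=
  ⟨hf.1.sub hg.1, (HsNormSq_sub_le s hf.1 hg.1).trans_lt
    (ENNReal.mul_lt_top (by simp) (ENNReal.add_lt_top.2 ⟨hf.2, hg.2⟩))⟩

lemma sobWeight_smul_le {s : ℝ} (hs : 0 ≤ s) {c : ℝ} (hc : 0 < c) (hc2 : c ≤ 2) (ξ : E3) :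
    sobWeight s (c • ξ) ≤ ENNReal.ofReal (4 ^ s) * sobWeight s ξ := by
  unfold sobWeight
  rw [← ENNReal.ofReal_mul (by positivity), ← Real.mul_rpow (by norm_num) (by positivity)]
  gcongr
  rw [norm_smul, Real.norm_of_nonneg hc.le, mul_pow]
  have : c ^ 2 ≤ 4 := by nlinarith
  nlinarith [sq_nonneg ‖ξ‖]

/-- Dilations by a factor in `[1/2, 2]` are uniformly bounded on `H^s`. -/
lemma HsNormSq_comp_smul_le {s : ℝ} (hs : 0 ≤ s) (f : E3 → ℂ) {c : ℝ} (hc : 1 / 2 ≤ c)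
    (hc2 : c ≤ 2) :
    HsNormSq s (fun x => f (c • x)) ≤ ENNReal.ofReal (8 * 4 ^ s) * HsNormSq s f := by
  have hc0 : 0 < c := by linarith
  have h₁ : HsNormSq s (fun x => f (c • x)) =
      ENNReal.ofReal ((c ^ 3)⁻¹ ^ 2) *
        ∫⁻ ξ, sobWeight s (c • (c⁻¹ • ξ)) * ‖𝓕 f (c⁻¹ • ξ)‖ₑ ^ 2 := by
    rw [HsNormSq_eq, ← lintegral_const_mul' _ _ ENNReal.ofReal_ne_top]
    refine lintegral_congr fun ξ => ?_
    rw [fourier_comp_smul f hc0, smul_inv_smul₀ hc0.ne', enorm_smul, mul_pow,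
      Real.enorm_of_nonneg (by positivity), ← ENNReal.ofReal_pow (by positivity)]
    simp only [finrank_euclideanSpace, Fintype.card_fin]
    ring
  rw [h₁, lintegral_comp_smul (fun ξ => sobWeight s (c • ξ) * ‖𝓕 f ξ‖ₑ ^ 2) (inv_pos.2 hc0),
    ← mul_assoc, ← ENNReal.ofReal_mul (by positivity)]
  simp only [finrank_euclideanSpace, Fintype.card_fin]
  have h₂ : (c ^ 3)⁻¹ ^ 2 * (c⁻¹ ^ 3)⁻¹ ≤ 8 := by
    have : (c ^ 3)⁻¹ ^ 2 * (c⁻¹ ^ 3)⁻¹ = (c⁻¹) ^ 3 := by field_simp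
    rw [this]
    have : c⁻¹ ≤ 2 := by
      rw [inv_le_comm₀ hc0 (by norm_num)]
      linarith
    calc (c⁻¹) ^ 3 ≤ 2 ^ 3 := by gcongr
      _ = 8 := by norm_num
  calc _ ≤ ENNReal.ofReal 8 *
        ∫⁻ ξ, ENNReal.ofReal (4 ^ s) * sobWeight s ξ * ‖𝓕 f ξ‖ₑ ^ 2 := by
        gcongr with ξ
        exact sobWeight_smul_le hs hc0 hc2 ξ
    _ = _ := by
      simp only [mul_assoc]
      rw [lintegral_const_mul' _ _ ENNReal.ofReal_ne_top, ← mul_assoc,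
        ← ENNReal.ofReal_mul (by norm_num), HsNormSq_eq]

lemma MemHs.comp_smul {s : ℝ} (hs : 0 ≤ s) {f : E3 → ℂ} (hf : MemHs s f) {c : ℝ}
    (hc : 1 / 2 ≤ c) (hc2 : c ≤ 2) : MemHs s (fun x => f (c • x)) :=
  ⟨hf.1.comp_smul (by linarith), (HsNormSq_comp_smul_le hs f hc hc2).trans_lt
    (ENNReal.mul_lt_top ENNReal.ofReal_lt_top hf.2)⟩

/-- Uniform `H^s` bounds for smooth functions supported in a fixed ball from uniform bounds on
finitely many derivatives. -/
lemma exists_HsNormSq_le_of_iteratedFDeriv_le (s R : ℝ) (C : ℕ → ℝ) :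
    ∃ M : ℝ≥0∞, M < ⊤ ∧ ∀ φ : E3 → ℝ, ContDiff ℝ (⊤ : ℕ∞) φ → (∀ x, φ x ≠ 0 → ‖x‖ ≤ R) →
      (∀ n x, ‖iteratedFDeriv ℝ n φ x‖ ≤ C n) →
      MemHs s (fun x => (φ x : ℂ)) ∧ HsNormSq s (fun x => (φ x : ℂ)) ≤ M := by
  set v : ℝ := (volume : Measure E3).real (Metric.closedBall 0 R)
  set B : ℕ → ℝ := fun n => 2 ^ n * ∑ p ∈ Finset.range (n + 1), C p * v with hB
  obtain ⟨n, hn⟩ := exists_nat_gt (s + 3 / 2)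
  set D : ℝ := 2 ^ (n - 1) * (B 0 ^ 2 + B n ^ 2) with hD
  have hfin : ENNReal.ofReal D * ∫⁻ ξ, sobWeight (-(n - s)) ξ < ⊤ :=
    ENNReal.mul_lt_top ENNReal.ofReal_lt_top (lintegral_sobWeight_neg_lt_top (by linarith))
  refine ⟨_, hfin, fun φ hφ hsupp hC => ?_⟩
  set f : E3 → ℂ := fun x => (φ x : ℂ) with hf
  have hfs : ContDiff ℝ (⊤ : ℕ∞) f := Complex.ofRealCLM.contDiff.comp hφ
  have hts : tsupport f ⊆ Metric.closedBall 0 R := by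
    refine closure_minimal (fun x hx => ?_) Metric.isClosed_closedBall
    simpa using hsupp x (by simpa [hf] using hx)
  have hcs : HasCompactSupport f :=
    (isCompact_closedBall 0 R).of_isClosed_subset (isClosed_tsupport f) hts
  have hdn : ∀ k x, ‖iteratedFDeriv ℝ k f x‖ ≤ C k := by
    intro k x
    refine le_trans (le_of_eq ?_) (hC k x)
    exact Complex.ofRealLI.norm_iteratedFDeriv_comp_left (hφ.contDiffAt) (mod_cast le_top)
  have hdi : ∀ k, Integrable (fun x => ‖iteratedFDeriv ℝ k f x‖) := fun k =>
    ((hfs.continuous_iteratedFDeriv (mod_cast le_top)).integrable_of_hasCompactSupport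
      (hcs.iteratedFDeriv k)).norm
  have hdint : ∀ k, ∫ x, ‖iteratedFDeriv ℝ k f x‖ ≤ C k * v := by
    intro k
    have hzero : ∀ x, x ∉ Metric.closedBall (0 : E3) R → ‖iteratedFDeriv ℝ k f x‖ = 0 := by
      intro x hx
      rw [norm_eq_zero]
      exact image_eq_zero_of_notMem_tsupport
        (fun h => hx (hts (tsupport_iteratedFDeriv_subset k h)))
    rw [← setIntegral_eq_integral_of_forall_compl_eq_zero hzero]
    have := norm_setIntegral_le_of_norm_le_const (μ := volume)
      (measure_closedBall_lt_top (x := (0 : E3)) (r := R))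
      (f := fun x => ‖iteratedFDeriv ℝ k f x‖) (C := C k) (fun x _ => by simpa using hdn k x)
    exact (le_abs_self _).trans this
  have hfour : ∀ k ξ, ‖ξ‖ ^ k * ‖𝓕 f ξ‖ ≤ B k := by
    intro k ξ
    have h := pow_mul_norm_iteratedFDeriv_fourier_le (f := f) (K := 0) (N := ⊤) (k := 0) (n := k)
      hfs ?_ le_rfl le_top ξ
    · simp only [norm_iteratedFDeriv_zero, pow_zero, CharP.cast_eq_zero, mul_zero, zero_add,
        one_mul, Finset.range_one, Finset.singleton_product, Finset.sum_map,
        Function.Embedding.coeFn_mk] at h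
      refine h.trans ?_
      simp only [hB]
      gcongr
      exact hdint _
    · intro i j hi _
      have : i = 0 := by simpa using hi
      subst this
      simpa using hdi j
  have hpt : ∀ ξ, sobWeight s ξ * ‖𝓕 f ξ‖ₑ ^ 2 ≤
      ENNReal.ofReal D * sobWeight (-(n - s)) ξ := by
    intro ξ
    have h₁ : (1 + ‖ξ‖ ^ 2) ^ (n : ℝ) * ‖𝓕 f ξ‖ ^ 2 ≤ D := by
      rw [Real.rpow_natCast]
      have h₀ := hfour 0 ξ
      have hn' := hfour n ξ
      rw [pow_zero, one_mul] at h₀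
      calc _ ≤ 2 ^ (n - 1) * (1 ^ n + (‖ξ‖ ^ 2) ^ n) * ‖𝓕 f ξ‖ ^ 2 := by
            gcongr
            exact add_pow_le (by norm_num) (by positivity) n
        _ = 2 ^ (n - 1) * (‖𝓕 f ξ‖ ^ 2 + (‖ξ‖ ^ n * ‖𝓕 f ξ‖) ^ 2) := by
            rw [one_pow, mul_pow, ← pow_mul, ← pow_mul, mul_comm n 2]
            ring
        _ ≤ D := by
            rw [hD]
            gcongr
    have h₂ : sobWeight s ξ = sobWeight (-(n - s)) ξ * sobWeight n ξ := by
      rw [← sobWeight_add]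
      congr 1
      ring
    rw [h₂, mul_assoc, mul_comm]
    gcongr
    rw [sobWeight, ← ofReal_norm, ← ENNReal.ofReal_pow (norm_nonneg _),
      ← ENNReal.ofReal_mul (by positivity)]
    exact ENNReal.ofReal_le_ofReal h₁
  have hle : HsNormSq s f ≤ ENNReal.ofReal D * ∫⁻ ξ, sobWeight (-(n - s)) ξ := by
    rw [HsNormSq_eq, ← lintegral_const_mul' _ _ ENNReal.ofReal_ne_top]
    exact lintegral_mono hpt
  exact ⟨⟨hfs.continuous.integrable_of_hasCompactSupport hcs, hle.trans_lt hfin⟩, hle⟩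

end Sobolev

section Weighted

variable (P : DyadicPartition)

/-- The localization `ψ_k u` rescaled by `2^j`. -/
def locAt (k j : ℕ) (u : E3 → ℝ) (x : E3) : ℂ :=
  ((P.ψ k (((2 : ℝ) ^ j) • x) * u (((2 : ℝ) ^ j) • x) : ℝ) : ℂ)

/-- The cutoff `ψ_k` rescaled by `2^j`. -/
def cutoff (k j : ℕ) (x : E3) : ℂ := ((P.ψ k (((2 : ℝ) ^ j) • x) : ℝ) : ℂ)

lemma HwNormSq_eq (s δ : ℝ) (u : E3 → ℝ) :
    HwNormSq P s δ u = ∑' j : ℕ, ENNReal.ofReal ((2 : ℝ) ^ ((3 + 2 * δ) * (j : ℝ))) *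
      HsNormSq s (locAt P j j u) := rfl

lemma scale_smul (k j : ℕ) (x : E3) :
    ((2 : ℝ) ^ k) • (((2 : ℝ) ^ j / 2 ^ k) • x) = ((2 : ℝ) ^ j) • x := by
  rw [smul_smul, mul_div_cancel₀ _ (by positivity)]

lemma half_le_scale {k j : ℕ} (h : k ≤ j + 1) : (1 : ℝ) / 2 ≤ 2 ^ j / 2 ^ k := by
  rw [div_le_div_iff₀ (by norm_num) (by positivity), one_mul, ← pow_succ]
  exact pow_le_pow_right₀ (by norm_num) h

lemma scale_le_two {k j : ℕ} (h : j ≤ k + 1) : (2 : ℝ) ^ j / 2 ^ k ≤ 2 := by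
  rw [div_le_iff₀ (by positivity), ← pow_succ']
  exact pow_le_pow_right₀ (by norm_num) h

lemma norm_le_of_ψ_ne_zero (j : ℕ) (x : E3) (hx : P.ψ j x ≠ 0) : ‖x‖ ≤ 2 ^ (j + 1) := by
  rcases Nat.eq_zero_or_pos j with rfl | hj
  · simpa using P.supp_zero x hx
  · exact_mod_cast (P.supp_succ j hj x hx).2

lemma exists_cutoff_bound {s : ℝ} (hs : 0 ≤ s) : ∃ M : ℝ≥0∞, M < ⊤ ∧
    ∀ k j, k ≤ j + 1 → j ≤ k + 1 → MemHs s (cutoff P k j) ∧ HsNormSq s (cutoff P k j) ≤ M := by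
  choose C hC using P.deriv_bound
  obtain ⟨M, hM, hb⟩ := exists_HsNormSq_le_of_iteratedFDeriv_le s 2 C
  have hdiag : ∀ k, MemHs s (cutoff P k k) ∧ HsNormSq s (cutoff P k k) ≤ M := by
    intro k
    refine hb (fun x => P.ψ k (((2 : ℝ) ^ k) • x)) ((P.smooth k).comp (by fun_prop)) ?_ ?_
    · intro x hx
      have h := norm_le_of_ψ_ne_zero P k _ hx
      rw [norm_smul, Real.norm_of_nonneg (by positivity), pow_succ] at h
      exact le_of_mul_le_mul_left h (by positivity)
    · intro n x
      rw [iteratedFDeriv_comp_const_smul _ ((P.smooth k).of_le (mod_cast le_top))]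
      simp only [norm_smul, norm_pow, Real.norm_ofNat]
      have hpow : ((2 : ℝ) ^ k) ^ n * 2 ^ (-(n : ℤ) * (k : ℤ)) = 1 := by
        rw [← pow_mul, ← zpow_natCast, ← zpow_add₀ (by norm_num)]
        simp [mul_comm]
      calc _ ≤ ((2 : ℝ) ^ k) ^ n * (C n * 2 ^ (-(n : ℤ) * (k : ℤ))) := by
            gcongr
            exact hC n k _
        _ = C n * (((2 : ℝ) ^ k) ^ n * 2 ^ (-(n : ℤ) * (k : ℤ))) := by ring
        _ = C n := by rw [hpow, mul_one]
  refine ⟨ENNReal.ofReal (8 * 4 ^ s) * M, ENNReal.mul_lt_top ENNReal.ofReal_lt_top hM,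
    fun k j hkj hjk => ?_⟩
  have heq : cutoff P k j = fun x => cutoff P k k (((2 : ℝ) ^ j / 2 ^ k) • x) := by
    ext x
    rw [cutoff, cutoff, scale_smul]
  rw [heq]
  refine ⟨(hdiag k).1.comp_smul hs (half_le_scale hkj) (scale_le_two hjk), ?_⟩
  refine (HsNormSq_comp_smul_le hs _ (half_le_scale hkj) (scale_le_two hjk)).trans ?_
  gcongr
  exact (hdiag k).2

lemma memHs_locAt_self {s δ : ℝ} {u : E3 → ℝ} (hu : MemH P s δ u) (k : ℕ) :
    MemHs s (locAt P k k u) := by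
  constructor
  · have h := hu.1.integrable_smul_left_of_hasCompactSupport (P.smooth k).continuous
      (P.compSupp k)
    exact (h.comp_smul (R := (2 : ℝ) ^ k) (by positivity)).ofReal
  · have h := (ENNReal.le_tsum k).trans_lt (HwNormSq_eq P s δ u ▸ hu.2)
    refine lt_top_iff_ne_top.2 fun htop => ?_
    rw [htop, ENNReal.mul_top] at h
    · exact lt_irrefl _ h
    · simp only [ne_eq, ENNReal.ofReal_eq_zero, not_le]
      positivity

lemma memHs_locAt {s δ : ℝ} (hs : 0 ≤ s) {u : E3 → ℝ} (hu : MemH P s δ u) {k j : ℕ}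
    (hkj : k ≤ j + 1) (hjk : j ≤ k + 1) :
    MemHs s (locAt P k j u) ∧
      HsNormSq s (locAt P k j u) ≤ ENNReal.ofReal (8 * 4 ^ s) * HsNormSq s (locAt P k k u) := by
  have heq : locAt P k j u = fun x => locAt P k k u (((2 : ℝ) ^ j / 2 ^ k) • x) := by
    ext x
    rw [locAt, locAt, scale_smul]
  rw [heq]
  exact ⟨(memHs_locAt_self P hu k).comp_smul hs (half_le_scale hkj) (scale_le_two hjk),
    HsNormSq_comp_smul_le hs _ (half_le_scale hkj) (scale_le_two hjk)⟩

lemma memHs_sub_mul {s : ℝ} (hs : 3 / 2 < s) {p f : E3 → ℂ} {M : ℝ≥0∞} (hp : MemHs s p)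
    (hpM : HsNormSq s p ≤ M) (hf : MemHs s f) :
    MemHs s (fun x => f x - p x * f x) ∧
      HsNormSq s (fun x => f x - p x * f x) ≤ 2 * (1 + algConst s * M) * HsNormSq s f := by
  have hm := hp.mul hs hf
  refine ⟨hf.sub hm, (HsNormSq_sub_le s hf.1 hm.1).trans ?_⟩
  calc _ ≤ 2 * (HsNormSq s f + algConst s * (M * HsNormSq s f)) := by
        gcongr
        refine (HsNormSq_mul_le hs hp hf.1).trans ?_
        gcongr
    _ = _ := by ring

/-- The function `u` near the support of `ψ_j`, rescaled by `2^j`: the cutoff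
`1 - (1 - ψ_{j-1}) (1 - ψ_j) (1 - ψ_{j+1})` is identically `1` there. -/
def nearLoc (j : ℕ) (u : E3 → ℝ) (x : E3) : ℂ :=
  locAt P (j - 1) j u x + ((locAt P j j u x - cutoff P (j - 1) j x * locAt P j j u x) +
    ((locAt P (j + 1) j u x - cutoff P (j - 1) j x * locAt P (j + 1) j u x) -
      cutoff P j j x * (locAt P (j + 1) j u x - cutoff P (j - 1) j x * locAt P (j + 1) j u x)))

lemma exists_nearLoc_bound {s : ℝ} (hs : 3 / 2 < s) : ∃ L : ℝ≥0∞, L < ⊤ ∧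
    ∀ (δ : ℝ) (u : E3 → ℝ), MemH P s δ u → ∀ j, MemHs s (nearLoc P j u) ∧
      HsNormSq s (nearLoc P j u) ≤ L * (HsNormSq s (locAt P (j - 1) (j - 1) u) +
        HsNormSq s (locAt P j j u) + HsNormSq s (locAt P (j + 1) (j + 1) u)) := by
  have hs0 : 0 ≤ s := by linarith
  obtain ⟨M, hM, hcut⟩ := exists_cutoff_bound P hs0
  set A := ENNReal.ofReal (8 * 4 ^ s)
  set N := 2 * (1 + algConst s * M)
  have hA : A < ⊤ := ENNReal.ofReal_lt_top
  have hN1 : N < ⊤ := ENNReal.mul_lt_top (by simp)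
    (ENNReal.add_lt_top.2 ⟨by simp, ENNReal.mul_lt_top (algConst_lt_top hs) hM⟩)
  refine ⟨2 * A + 4 * (N * A) + 4 * (N * (N * A)), ?_, fun δ u hu j => ?_⟩
  · simp only [ENNReal.add_lt_top, ENNReal.mul_lt_top_iff, hA, hN1]
    simp
  obtain ⟨ha, hab⟩ := memHs_locAt P hs0 hu (k := j - 1) (j := j) (by lia) (by lia)
  obtain ⟨hb, hbb⟩ := memHs_locAt P hs0 hu (k := j) (j := j) (by lia) (by lia)
  obtain ⟨hc, hcb⟩ := memHs_locAt P hs0 hu (k := j + 1) (j := j) (by lia) (by lia)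
  obtain ⟨hp, hpb⟩ := hcut (j - 1) j (by lia) (by lia)
  obtain ⟨hq, hqb⟩ := hcut j j (by lia) (by lia)
  obtain ⟨hb', hbb'⟩ := memHs_sub_mul hs hp hpb hb
  obtain ⟨hc', hcb'⟩ := memHs_sub_mul hs hp hpb hc
  obtain ⟨hc'', hcb''⟩ := memHs_sub_mul hs hq hqb hc'
  refine ⟨ha.add (hb'.add hc''), (HsNormSq_add_le s ha.1 (hb'.add hc'').1).trans ?_⟩
  set x := HsNormSq s (locAt P (j - 1) (j - 1) u)
  set y := HsNormSq s (locAt P j j u)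
  set z := HsNormSq s (locAt P (j + 1) (j + 1) u)
  calc _ ≤ 2 * (A * x + 2 * (N * (A * y) + N * (N * (A * z)))) := by
        gcongr
        refine (HsNormSq_add_le s hb'.1 hc''.1).trans ?_
        gcongr
        · exact hbb'.trans (by gcongr)
        · exact hcb''.trans (by gcongr; exact hcb'.trans (by gcongr))
    _ = 2 * A * x + 4 * (N * A) * y + 4 * (N * (N * A)) * z := by ring
    _ ≤ (2 * A + 4 * (N * A) + 4 * (N * (N * A))) * x +
        (2 * A + 4 * (N * A) + 4 * (N * (N * A))) * y +
        (2 * A + 4 * (N * A) + 4 * (N * (N * A))) * z := by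
      gcongr
      · exact le_self_add.trans le_self_add
      · exact le_add_self.trans le_self_add
      · exact le_add_self
    _ = _ := by ring

lemma exists_ψ_eq_one {J : ℕ} {y : E3} (hy : ‖y‖ ≤ 2 ^ J) : ∃ j ≤ J, P.ψ j y = 1 := by
  induction J with
  | zero => exact ⟨0, le_rfl, P.one_zero y (by simpa using hy)⟩
  | succ J ih =>
    rcases le_total ‖y‖ (2 ^ J) with h | h
    · obtain ⟨j, hj, hj1⟩ := ih h
      exact ⟨j, by lia, hj1⟩
    · exact ⟨J + 1, le_rfl, P.one_succ (J + 1) (by lia) y (by simpa using h) (mod_cast hy)⟩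

lemma ψ_neighbor_eq_one {j : ℕ} {y : E3} (hy : P.ψ j y ≠ 0) :
    P.ψ (j - 1) y = 1 ∨ P.ψ j y = 1 ∨ P.ψ (j + 1) y = 1 := by
  have hup := norm_le_of_ψ_ne_zero P j y hy
  rcases le_total (2 ^ j) ‖y‖ with h | h
  · exact Or.inr (Or.inr (P.one_succ (j + 1) (by lia) y (by simpa using h) (mod_cast hup)))
  rcases j with _ | j
  · exact Or.inl (P.one_zero y (by simpa using h))
  rcases le_total (2 ^ j) ‖y‖ with h' | h'
  · exact Or.inr (Or.inl (P.one_succ (j + 1) (by lia) y (by simpa using h') (mod_cast h)))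
  refine Or.inl ?_
  rcases j with _ | j
  · exact P.one_zero y (by simpa using h')
  · have hlow := (P.supp_succ (j + 1 + 1) (by lia) y hy).1
    refine P.one_succ (j + 1) (by lia) y ?_ (mod_cast h')
    convert hlow using 2
    push_cast
    ring

lemma nearLoc_eq_of_cutoff_ne_zero (j : ℕ) (u : E3 → ℝ) (x : E3) (h : cutoff P j j x ≠ 0) :
    nearLoc P j u x = (u (((2 : ℝ) ^ j) • x) : ℂ) := by
  have h' : P.ψ j (((2 : ℝ) ^ j) • x) ≠ 0 := by simpa [cutoff] using h
  simp only [nearLoc, locAt, cutoff]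
  rcases ψ_neighbor_eq_one P h' with h | h | h <;> rw [h] <;> push_cast <;> ring

lemma locAt_prod {m : ℕ} (u : Fin m → E3 → ℝ) (j : ℕ) :
    locAt P j j (fun x => ∏ i, u i x) = fun x => cutoff P j j x * ∏ i, nearLoc P j (u i) x := by
  ext x
  by_cases h : cutoff P j j x = 0
  · have h' : P.ψ j (((2 : ℝ) ^ j) • x) = 0 := by simpa [cutoff] using h
    simp [locAt, h, h']
  · rw [Finset.prod_congr rfl fun i _ => nearLoc_eq_of_cutoff_ne_zero P j (u i) x h]
    simp [locAt, cutoff]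

lemma memHs_mul_prod {s : ℝ} (hs : 3 / 2 < s) {ι : Type*} (S : Finset ι) {p : E3 → ℂ}
    {v : ι → E3 → ℂ} (hp : MemHs s p) (hv : ∀ i, MemHs s (v i)) :
    MemHs s (fun x => p x * ∏ i ∈ S, v i x) ∧
      HsNormSq s (fun x => p x * ∏ i ∈ S, v i x) ≤
        HsNormSq s p * ∏ i ∈ S, (algConst s * HsNormSq s (v i)) := by
  classical
  induction S using Finset.induction_on with
  | empty => simpa using hp
  | insert a S ha ih =>
    have heq : (fun x => p x * ∏ i ∈ insert a S, v i x) =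
        fun x => v a x * (p x * ∏ i ∈ S, v i x) := by
      ext x
      rw [Finset.prod_insert ha]
      ring
    rw [heq, Finset.prod_insert ha]
    refine ⟨(hv a).mul hs ih.1, (HsNormSq_mul_le hs (hv a) ih.1.1).trans ?_⟩
    calc _ ≤ algConst s * (HsNormSq s (v a) *
          (HsNormSq s p * ∏ i ∈ S, (algConst s * HsNormSq s (v i)))) := by
          gcongr
          exact ih.2
      _ = _ := by ring

lemma tsum_prod_le_prod_tsum {ι : Type*} {S : Finset ι} (hS : S.Nonempty) (B : ι → ℕ → ℝ≥0∞) :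
    ∑' j, ∏ i ∈ S, B i j ≤ ∏ i ∈ S, ∑' j, B i j := by
  induction hS using Finset.Nonempty.cons_induction with
  | singleton a => simp
  | cons a S ha hS ih =>
    simp only [Finset.prod_cons]
    calc ∑' j, B a j * ∏ i ∈ S, B i j ≤ ∑' j, B a j * ∏ i ∈ S, ∑' j, B i j := by
          refine ENNReal.tsum_le_tsum fun j => ?_
          gcongr
          exact ENNReal.le_tsum j
      _ = _ := ENNReal.tsum_mul_right

lemma tsum_neighbors_le (A : ℕ → ℝ≥0∞) :
    ∑' j, (A (j - 1) + A j + A (j + 1)) ≤ 4 * ∑' j, A j := by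
  rw [ENNReal.tsum_add, ENNReal.tsum_add]
  have h₁ : ∑' j, A (j - 1) ≤ 2 * ∑' j, A j := by
    rw [tsum_eq_zero_add' ENNReal.summable, two_mul]
    simp only [Nat.zero_sub, Nat.add_sub_cancel]
    gcongr
    exact ENNReal.le_tsum 0
  have h₂ : ∑' j, A (j + 1) ≤ ∑' j, A j := by
    rw [tsum_eq_zero_add' (f := A) ENNReal.summable]
    exact le_add_self
  calc _ ≤ 2 * (∑' j, A j) + ∑' j, A j + ∑' j, A j := by gcongr
    _ = _ := by ring

lemma two_rpow_mul_le (e : ℝ) {k j : ℕ} (hkj : k ≤ j + 1) (hjk : j ≤ k + 1) :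
    ENNReal.ofReal ((2 : ℝ) ^ (e * (j : ℝ))) ≤
      ENNReal.ofReal ((2 : ℝ) ^ |e|) * ENNReal.ofReal ((2 : ℝ) ^ (e * (k : ℝ))) := by
  rw [← ENNReal.ofReal_mul (by positivity), ← Real.rpow_add (by norm_num)]
  refine ENNReal.ofReal_le_ofReal (Real.rpow_le_rpow_of_exponent_le (by norm_num) ?_)
  have h₁ : |(j : ℝ) - k| ≤ 1 := by
    rw [abs_le]
    constructor
    · have : (k : ℝ) ≤ j + 1 := mod_cast hkj
      linarith
    · have : (j : ℝ) ≤ k + 1 := mod_cast hjk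
      linarith
  have h₂ : e * (j - k) ≤ |e| := by
    refine (le_abs_self _).trans ?_
    rw [abs_mul]
    exact mul_le_of_le_one_right (abs_nonneg e) h₁
  linarith

/-- A measurable function all of whose dyadic localizations are integrable is locally
integrable. -/
lemma locallyIntegrable_of_locAt {u : E3 → ℝ} (hu : AEStronglyMeasurable u volume)
    (h : ∀ j, Integrable (locAt P j j u)) : LocallyIntegrable u volume := by
  have hψ : ∀ j, Integrable (fun x => P.ψ j x * u x) := by
    intro j
    have h' := ((h j).re).comp_smul (R := ((2 : ℝ) ^ j)⁻¹) (by positivity)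
    refine h'.congr (ae_of_all _ fun x => ?_)
    simp [locAt, smul_smul]
  intro x
  obtain ⟨J, hJ⟩ := pow_unbounded_of_one_lt ‖x‖ (one_lt_two)
  refine ⟨Metric.ball 0 (2 ^ J), Metric.isOpen_ball.mem_nhds (by simpa using hJ), ?_⟩
  have hsum : Integrable (fun x => ∑ j ∈ Finset.range (J + 1), ‖P.ψ j x * u x‖) :=
    integrable_finsetSum _ fun j _ => (hψ j).norm
  refine hsum.integrableOn.mono' hu.restrict ?_
  refine (ae_restrict_iff' measurableSet_ball).2 (ae_of_all _ fun y hy => ?_)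
  obtain ⟨j, hj, hj1⟩ := exists_ψ_eq_one P (J := J) (y := y) (mem_ball_zero_iff.1 hy).le
  calc ‖u y‖ = ‖P.ψ j y * u y‖ := by rw [hj1, one_mul]
    _ ≤ _ := Finset.single_le_sum (f := fun j => ‖P.ψ j y * u y‖) (fun _ _ => norm_nonneg _)
      (Finset.mem_range.2 (by lia))

lemma exists_HwNormSq_prod_le {s δ : ℝ} {m : ℕ} (hm : 0 < m) (δs : Fin m → ℝ) (hs : 3 / 2 < s)
    (hδ : δ ≤ (∑ i, δs i) + 3 * ((m : ℝ) - 1) / 2) :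
    ∃ Q : ℝ≥0∞, Q < ⊤ ∧ ∀ u : Fin m → E3 → ℝ, (∀ i, MemH P s (δs i) (u i)) →
      HwNormSq P s δ (fun x => ∏ i, u i x) ≤ Q * ∏ i, HwNormSq P s (δs i) (u i) := by
  obtain ⟨M, hM, hcut⟩ := exists_cutoff_bound P (s := s) (by linarith)
  obtain ⟨L, hL, hnear⟩ := exists_nearLoc_bound P hs
  set T : Fin m → ℝ≥0∞ := fun i => algConst s * L * ENNReal.ofReal ((2 : ℝ) ^ |3 + 2 * δs i|)
  have hT : ∀ i, T i < ⊤ := fun i =>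
    ENNReal.mul_lt_top (ENNReal.mul_lt_top (algConst_lt_top hs) hL) ENNReal.ofReal_lt_top
  refine ⟨M * ∏ i, (T i * 4), ENNReal.mul_lt_top hM
    (ENNReal.prod_lt_top fun i _ => ENNReal.mul_lt_top (hT i) (by simp)), fun u hu => ?_⟩
  set A : Fin m → ℕ → ℝ≥0∞ := fun i k =>
    ENNReal.ofReal ((2 : ℝ) ^ ((3 + 2 * δs i) * (k : ℝ))) * HsNormSq s (locAt P k k (u i)) with hA
  have hweight : ∀ j : ℕ, ENNReal.ofReal ((2 : ℝ) ^ ((3 + 2 * δ) * (j : ℝ))) ≤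
      ∏ i, ENNReal.ofReal ((2 : ℝ) ^ ((3 + 2 * δs i) * (j : ℝ))) := by
    intro j
    rw [← ENNReal.ofReal_prod_of_nonneg fun i _ => by positivity,
      ← Real.rpow_sum_of_pos (by norm_num)]
    refine ENNReal.ofReal_le_ofReal (Real.rpow_le_rpow_of_exponent_le (by norm_num) ?_)
    rw [← Finset.sum_mul, Finset.sum_add_distrib, ← Finset.mul_sum]
    simp only [Finset.sum_const, Finset.card_univ, Fintype.card_fin, nsmul_eq_mul]
    refine mul_le_mul_of_nonneg_right ?_ (Nat.cast_nonneg j)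
    linarith
  have hterm : ∀ j : ℕ, ENNReal.ofReal ((2 : ℝ) ^ ((3 + 2 * δ) * (j : ℝ))) *
      HsNormSq s (locAt P j j (fun x => ∏ i, u i x)) ≤
        (M * ∏ i, T i) * ∏ i, (A i (j - 1) + A i j + A i (j + 1)) := by
    intro j
    obtain ⟨hp, hpM⟩ := hcut j j (by lia) (by lia)
    have hprod := (memHs_mul_prod hs Finset.univ hp fun i => (hnear _ _ (hu i) j).1).2
    rw [locAt_prod]
    calc _ ≤ (∏ i, ENNReal.ofReal ((2 : ℝ) ^ ((3 + 2 * δs i) * (j : ℝ)))) *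
          (M * ∏ i, (algConst s * HsNormSq s (nearLoc P j (u i)))) := by
          gcongr
          · exact hweight j
          · exact hprod.trans (by gcongr)
      _ = M * ∏ i, (ENNReal.ofReal ((2 : ℝ) ^ ((3 + 2 * δs i) * (j : ℝ))) *
          (algConst s * HsNormSq s (nearLoc P j (u i)))) := by
          rw [Finset.prod_mul_distrib (f := fun i => ENNReal.ofReal _)]
          ring
      _ ≤ M * ∏ i, (T i * (A i (j - 1) + A i j + A i (j + 1))) := by
          refine mul_le_mul' le_rfl (Finset.prod_le_prod' fun i _ => ?_)
          set w := ENNReal.ofReal ((2 : ℝ) ^ |3 + 2 * δs i|)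
          set W := ENNReal.ofReal ((2 : ℝ) ^ ((3 + 2 * δs i) * (j : ℝ)))
          have hk : ∀ k, k ≤ j + 1 → j ≤ k + 1 →
              W * HsNormSq s (locAt P k k (u i)) ≤ w * A i k := by
            intro k h₁ h₂
            rw [hA, ← mul_assoc]
            gcongr
            exact two_rpow_mul_le _ h₁ h₂
          calc _ ≤ W * (algConst s * (L * (HsNormSq s (locAt P (j - 1) (j - 1) (u i)) +
                HsNormSq s (locAt P j j (u i)) +
                HsNormSq s (locAt P (j + 1) (j + 1) (u i))))) := by
                gcongr
                exact (hnear _ _ (hu i) j).2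
            _ = algConst s * L * (W * HsNormSq s (locAt P (j - 1) (j - 1) (u i)) +
                W * HsNormSq s (locAt P j j (u i)) +
                W * HsNormSq s (locAt P (j + 1) (j + 1) (u i))) := by ring
            _ ≤ algConst s * L * (w * A i (j - 1) + w * A i j + w * A i (j + 1)) := by
                exact mul_le_mul' le_rfl (add_le_add (add_le_add (hk _ (by lia) (by lia))
                  (hk _ (by lia) (by lia))) (hk _ (by lia) (by lia)))
            _ = _ := by ring
      _ = _ := by rw [Finset.prod_mul_distrib, mul_assoc]
  have : Nonempty (Fin m) := ⟨⟨0, hm⟩⟩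
  calc HwNormSq P s δ (fun x => ∏ i, u i x)
      ≤ ∑' j, (M * ∏ i, T i) * ∏ i, (A i (j - 1) + A i j + A i (j + 1)) :=
        ENNReal.tsum_le_tsum hterm
    _ = (M * ∏ i, T i) * ∑' j, ∏ i, (A i (j - 1) + A i j + A i (j + 1)) := ENNReal.tsum_mul_left
    _ ≤ (M * ∏ i, T i) * ∏ i, (4 * HwNormSq P s (δs i) (u i)) := by
        gcongr
        refine (tsum_prod_le_prod_tsum Finset.univ_nonempty
          fun i j => A i (j - 1) + A i j + A i (j + 1)).trans ?_
        gcongr with i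
        exact tsum_neighbors_le (A i)
    _ = _ := by
        simp only [Finset.prod_mul_distrib]
        ring

end Weighted

/-- Lemma: estimates for products of functions.
If `s > 3/2`, `m ≥ 2` and `δ ≤ δ₁ + ⋯ + δ_m + 3(m-1)/2`, then there is a constant `C`,
independent of the functions, such that for all `u i ∈ H_{s,δᵢ}` the product
`u₁ ⋯ u_m ∈ H_{s,δ}` with `‖u₁ ⋯ u_m‖_{H_{s,δ}} ≤ C ∏ ‖u i‖_{H_{s,δᵢ}}`. -/
theorem product_estimate (P : DyadicPartition) (s δ : ℝ) (m : ℕ) (hm : 2 ≤ m)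
    (δs : Fin m → ℝ) (hs : 3/2 < s)
    (hδ : δ ≤ (∑ i, δs i) + 3 * ((m : ℝ) - 1) / 2) :
    ∃ C : ℝ, 0 < C ∧ ∀ u : Fin m → E3 → ℝ,
      (∀ i, MemH P s (δs i) (u i)) →
      MemH P s δ (fun x => ∏ i, u i x) ∧
      Hnorm P s δ (fun x => ∏ i, u i x) ≤ C * ∏ i, Hnorm P s (δs i) (u i) := by
  obtain ⟨Q, hQ, hle⟩ := exists_HwNormSq_prod_le P (by lia) δs hs hδ
  refine ⟨√Q.toReal + 1, by positivity, fun u hu => ?_⟩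
  have hfin : Q * ∏ i, HwNormSq P s (δs i) (u i) < ⊤ :=
    ENNReal.mul_lt_top hQ (ENNReal.prod_lt_top fun i _ => (hu i).2)
  refine ⟨⟨?_, (hle u hu).trans_lt hfin⟩, ?_⟩
  · refine locallyIntegrable_of_locAt P ?_ fun j => ?_
    · exact Finset.aestronglyMeasurable_fun_prod _ fun i _ => (hu i).1.aestronglyMeasurable
    · obtain ⟨M, -, hcut⟩ := exists_cutoff_bound P (s := s) (by linarith)
      obtain ⟨L, -, hnear⟩ := exists_nearLoc_bound P hs
      rw [locAt_prod]
      exact (memHs_mul_prod hs Finset.univ (hcut j j (by lia) (by lia)).1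
        fun i => (hnear _ _ (hu i) j).1).1.1
  · calc Hnorm P s δ (fun x => ∏ i, u i x)
        ≤ √(Q * ∏ i, HwNormSq P s (δs i) (u i)).toReal :=
          Real.sqrt_le_sqrt (ENNReal.toReal_mono hfin.ne (hle u hu))
      _ = √Q.toReal * ∏ i, Hnorm P s (δs i) (u i) := by
          rw [ENNReal.toReal_mul, Real.sqrt_mul ENNReal.toReal_nonneg, ENNReal.toReal_prod,
            Real.sqrt_prod _ fun i _ => ENNReal.toReal_nonneg]
          rfl
      _ ≤ _ := by
          gcongr
          · exact Finset.prod_nonneg fun i _ => Real.sqrt_nonneg _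
          · linarith
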